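/- arXiv:1907.10333 — 4 statements merged into one kernel-verified Lean document; each statement's English description precedes it below -/
import Mathlib

section
/- Every maximal common generalization is a most specific generalization: if G is a common generalization of a set S of goals such that no common generalization of S has strictly larger cardinality than G, then there is no common generalization G' of S with G ⪯ G' and not G' ⪯ G. -/
open FirstOrder Language

/-- A goal `G` is more general than a goal `G'` (`G ⪯ G'`) if there is a
renaming (an injective map on variables) `ρ` with `G.image (Term.relabel ρ) ⊆ G'`. -/
def MoreGeneral {L : Language} {V : Type*} [DecidableEq (L.Term V)]
    (G G' : Finset (L.Term V)) : Prop :=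
  ∃ ρ : V → V, Function.Injective ρ ∧ G.image (Term.relabel ρ) ⊆ G'

/-- `G` is a common generalization of a set `S` of goals if `G ⪯ Gᵢ` for all `Gᵢ ∈ S`. -/
def CommonGen {L : Language} {V : Type*} [DecidableEq (L.Term V)]
    (S : Set (Finset (L.Term V))) (G : Finset (L.Term V)) : Prop :=
  ∀ Gi ∈ S, MoreGeneral G Gi

theorem FirstOrder.Language.Term.relabel_congr {L : Language} {α β : Type*} [DecidableEq α]
    {f g : α → β} (t : L.Term α) (h : ∀ x ∈ t.varFinset, f x = g x) :
    t.relabel f = t.relabel g := by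
  induction t with
  | var x => simpa using h x
  | func F ts ih =>
    simp only [Term.relabel, Term.func.injEq, heq_eq_eq, true_and]
    funext i
    exact ih i fun x hx => h x (Finset.mem_biUnion.2 ⟨i, Finset.mem_univ i, hx⟩)

theorem FirstOrder.Language.Term.relabel_injective {L : Language} {α β : Type*} {f : α → β}
    (hf : Function.Injective f) : Function.Injective (Term.relabel f : L.Term α → L.Term β) := by
  intro s
  induction s with
  | var x =>
    rintro (y | ⟨F, us⟩) h
    · simpa using hf (Term.var.inj h)
    · cases h
  | func F ts ih =>
    rintro (y | ⟨F', us⟩) h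
    · cases h
    · simp only [Term.relabel, Term.func.injEq] at h
      obtain ⟨rfl, hF, hts⟩ := h
      obtain rfl := eq_of_heq hF
      exact congrArg _ (funext fun i => ih i (congrFun (eq_of_heq hts) i))

/-- A renaming can be undone on a goal: some renaming maps `G.image (Term.relabel ρ)` back to
`G`. -/
theorem moreGeneral_image_relabel {L : Language} {V : Type*} [DecidableEq (L.Term V)]
    (G : Finset (L.Term V)) {ρ : V → V} (hρ : Function.Injective ρ) :
    MoreGeneral (G.image (Term.relabel ρ)) G := by
  classical
  let F : Finset V := G.biUnion Term.varFinset
  obtain ⟨σ, hσ⟩ := Equiv.Perm.exists_extending_pair (fun x : F => ρ x) Subtype.val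
    (hρ.comp Subtype.val_injective) Subtype.val_injective
  refine ⟨σ, σ.injective, ?_⟩
  rw [Finset.image_image, Finset.image_subset_iff]
  intro t ht
  have hfix : t.relabel (σ ∘ ρ) = t.relabel id :=
    t.relabel_congr fun x hx => hσ ⟨x, Finset.mem_biUnion.2 ⟨t, ht, hx⟩⟩
  simpa [hfix, Term.relabel_id] using ht

/-- Every maximal common generalization is a most specific generalization: if no common
generalization of `S` has strictly larger cardinality than `G`, then there is no common
generalization `G'` of `S` with `G ⪯ G'` and not `G' ⪯ G`. -/
theorem msg_of_maximal {L : Language} {V : Type*}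
    [Countable V] [Infinite V] [DecidableEq (L.Term V)]
    (S : Set (Finset (L.Term V))) (G : Finset (L.Term V))
    (hG : CommonGen S G)
    (hmax : ¬ ∃ G' : Finset (L.Term V), CommonGen S G' ∧ G.card < G'.card) :
    ¬ ∃ G' : Finset (L.Term V),
        CommonGen S G' ∧ MoreGeneral G G' ∧ ¬ MoreGeneral G' G := by
  rintro ⟨G', hG', ⟨ρ, hρ, hsub⟩, hnot⟩
  have hcard : G'.card ≤ (G.image (Term.relabel ρ)).card := by
    rw [Finset.card_image_of_injective _ (Term.relabel_injective hρ)]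
    exact not_lt.1 fun hlt => hmax ⟨G', hG', hlt⟩
  rw [← Finset.eq_of_subset_of_card_le hsub hcard] at hnot
  exact hnot (moreGeneral_image_relabel G hρ)
end

section
/- Correctness of the graph-to-goal reduction: there exists an injective function ρ : α ⊕ β → α ⊕ β with (enc₁(G)).image (Term.relabel ρ) ⊆ enc₂(H) if and only if there exists an injective function f : α → β such that for all x y : α, G.Adj x y implies H.Adj (f x) (f y). -/
open FirstOrder Language Sum

/-- The function symbols of the reduction language: a unary `node` and a binary `edge`. -/
inductive NEFunc : ℕ → Type
  | node : NEFunc 1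
  | edge : NEFunc 2

/-- The first-order language with one unary function symbol `node` and one binary
function symbol `edge` (and no relation symbols). -/
def L' : Language := ⟨NEFunc, fun _ => Empty⟩

attribute [local instance] Classical.propDecidable

/-- The term `node(v)`. -/
def nodeT {W : Type*} (v : W) : L'.Term W := Term.func NEFunc.node ![Term.var v]

/-- The term `edge(v, w)`. -/
def edgeT {W : Type*} (v w : W) : L'.Term W :=
  Term.func NEFunc.edge ![Term.var v, Term.var w]

/-- The goal `{node(inl x) | x : α} ∪ {edge(inl x, inl y) | G.Adj x y}` encoding the
first graph over variables `α ⊕ β`. -/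
noncomputable def enc₁ {α : Type*} (β : Type*) [Fintype α] (G : SimpleGraph α) :
    Finset (L'.Term (α ⊕ β)) :=
  (Finset.univ.image fun x : α => nodeT (inl x : α ⊕ β)) ∪
    ((Finset.univ.filter fun p : α × α => G.Adj p.1 p.2).image
      fun p => edgeT (inl p.1 : α ⊕ β) (inl p.2))

/-- The goal `{node(inr u) | u : β} ∪ {edge(inr u, inr w) | H.Adj u w}` encoding the
second graph over variables `α ⊕ β`. -/
noncomputable def enc₂ (α : Type*) {β : Type*} [Fintype β] (H : SimpleGraph β) :
    Finset (L'.Term (α ⊕ β)) :=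
  (Finset.univ.image fun u : β => nodeT (inr u : α ⊕ β)) ∪
    ((Finset.univ.filter fun p : β × β => H.Adj p.1 p.2).image
      fun p => edgeT (inr p.1 : α ⊕ β) (inr p.2))

theorem nodeT_inj {W : Type*} {v w : W} : nodeT v = nodeT w ↔ v = w := by
  refine ⟨fun h => ?_, congrArg nodeT⟩
  injection h with _ _ h
  exact Term.var.inj (congrFun h 0)

theorem edgeT_inj {W : Type*} {v w v' w' : W} :
    edgeT v w = edgeT v' w' ↔ v = v' ∧ w = w' := by
  refine ⟨fun h => ?_, fun h => congrArg₂ edgeT h.1 h.2⟩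
  injection h with _ _ h
  exact ⟨Term.var.inj (congrFun h 0), Term.var.inj (congrFun h 1)⟩

theorem nodeT_ne_edgeT {W : Type*} (u v w : W) : nodeT u ≠ edgeT v w := by
  intro h
  cases h

theorem relabel_nodeT {W W' : Type*} (ρ : W → W') (v : W) :
    (nodeT v).relabel ρ = nodeT (ρ v) := by
  refine congrArg (Term.func _) (funext fun i => ?_)
  fin_cases i
  rfl

theorem relabel_edgeT {W W' : Type*} (ρ : W → W') (v w : W) :
    (edgeT v w).relabel ρ = edgeT (ρ v) (ρ w) := by
  refine congrArg (Term.func _) (funext fun i => ?_)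
  fin_cases i <;> rfl

theorem nodeT_mem_enc₂ {α β : Type*} [Fintype β] {H : SimpleGraph β} {v : α ⊕ β} :
    nodeT v ∈ enc₂ α H ↔ ∃ u, v = inr u := by
  simp [enc₂, nodeT_inj, (nodeT_ne_edgeT _ _ _).symm, @eq_comm _ (inr _) _]

theorem edgeT_mem_enc₂ {α β : Type*} [Fintype β] {H : SimpleGraph β} {v w : α ⊕ β} :
    edgeT v w ∈ enc₂ α H ↔ ∃ a b, H.Adj a b ∧ v = inr a ∧ w = inr b := by
  simp [enc₂, edgeT_inj, nodeT_ne_edgeT, @eq_comm _ (inr _) _]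

/-- A renaming maps the goal of `G` into the goal of `H` iff it sends the variables of `G` to
variables of `H` and edges to edges. -/
theorem image_enc₁_subset_enc₂_iff {α β : Type*} [Fintype α] [Fintype β]
    {G : SimpleGraph α} {H : SimpleGraph β} {ρ : α ⊕ β → α ⊕ β} :
    (enc₁ β G).image (Term.relabel ρ) ⊆ enc₂ α H ↔
      (∀ x, ∃ u, ρ (inl x) = inr u) ∧
        ∀ x y, G.Adj x y → ∃ a b, H.Adj a b ∧ ρ (inl x) = inr a ∧ ρ (inl y) = inr b := by
  simp only [enc₁, Finset.image_union, Finset.image_image, Finset.union_subset_iff,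
    Finset.image_subset_iff, Finset.mem_filter, Finset.mem_univ, true_and, forall_const,
    Function.comp_apply, relabel_nodeT, relabel_edgeT, nodeT_mem_enc₂, edgeT_mem_enc₂,
    Prod.forall]

/-- An injection `α → β` extends, along `inl` and `inr`, to an injective self-map of `α ⊕ β`. -/
theorem exists_injective_extending {α β : Type*} {f : α → β} (hf : Function.Injective f) :
    ∃ ρ : α ⊕ β → α ⊕ β, Function.Injective ρ ∧ ∀ x, ρ (inl x) = inr (f x) := by
  refine ⟨Sum.elim (inr ∘ f) fun u => if h : ∃ x, f x = u then inl h.choose else inr u,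
    Function.Injective.sumElim (inr_injective.comp hf) ?_ ?_, fun x => rfl⟩
  · intro u v huv
    dsimp only at huv
    split_ifs at huv with hu hv hv
    · rw [← hu.choose_spec, ← hv.choose_spec, inl_injective huv]
    · exact inr_injective huv
  · intro x u hxu
    dsimp only [Function.comp_apply] at hxu
    split_ifs at hxu with hu
    exact hu ⟨x, inr_injective hxu⟩

/-- Correctness of the graph-to-goal reduction: some injective renaming maps `enc₁ G`
into `enc₂ H` iff there is an injective `f : α → β` with `G.Adj x y → H.Adj (f x) (f y)`
for all `x y`. -/
theorem reduction_correct {α β : Type*} [Fintype α] [Fintype β]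
    (G : SimpleGraph α) (H : SimpleGraph β) :
    (∃ ρ : α ⊕ β → α ⊕ β, Function.Injective ρ ∧
        (enc₁ β G).image (Term.relabel ρ) ⊆ enc₂ α H) ↔
    (∃ f : α → β, Function.Injective f ∧
        ∀ x y : α, G.Adj x y → H.Adj (f x) (f y)) := by
  simp only [image_enc₁_subset_enc₂_iff]
  constructor
  · rintro ⟨ρ, hρ, hnode, hedge⟩
    choose f hf using hnode
    refine ⟨f, fun x y hxy => ?_, fun x y hxy => ?_⟩
    · exact inl_injective (hρ (by rw [hf, hf, hxy]))
    · obtain ⟨a, b, hab, ha, hb⟩ := hedge x y hxy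
      rw [hf] at ha hb
      rwa [inr_injective ha, inr_injective hb]
  · rintro ⟨f, hf, hadj⟩
    obtain ⟨ρ, hρ, hρf⟩ := exists_injective_extending hf
    exact ⟨ρ, hρ, fun x => ⟨f x, hρf x⟩,
      fun x y hxy => ⟨f x, f y, hadj x y hxy, hρf x, hρf y⟩⟩
end

section
/- A generalization mapping that is k-swap stable for every k ∈ ℕ is maximal: if φ is a generalization mapping of goals G₁ and G₂ that is k-swap stable for all k ∈ ℕ, then there is no generalization mapping ψ of G₁ and G₂ with |ψ| > |φ|. -/
open FirstOrder Language

/-- A generalization mapping of goals `G₁` and `G₂`: a finite set `φ` of pairs `(A, A')`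
with `A ∈ G₁` and `A' ∈ G₂`, injective in each coordinate (no term of `G₁` or of `G₂`
occurs in two pairs of `φ`), for which there exists an injective renaming `ρ` with
`Term.relabel ρ A = A'` for every `(A, A') ∈ φ`. -/
def IsGenMap {L : Language} {V : Type*} (G₁ G₂ : Finset (L.Term V))
    (φ : Finset (L.Term V × L.Term V)) : Prop :=
  (∀ p ∈ φ, p.1 ∈ G₁ ∧ p.2 ∈ G₂) ∧
  (∀ p ∈ φ, ∀ q ∈ φ, (p.1 = q.1 → p = q) ∧ (p.2 = q.2 → p = q)) ∧
  (∃ ρ : V → V, Function.Injective ρ ∧ ∀ p ∈ φ, Term.relabel ρ p.1 = p.2)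

/-- A generalization mapping `φ'` is a `k`-swap of `φ` if `|φ'| = |φ|` and
`|φ ∩ φ'| ≥ |φ| - k`. -/
def IsKSwap {L : Language} {V : Type*} [DecidableEq (L.Term V)]
    (G₁ G₂ : Finset (L.Term V)) (φ φ' : Finset (L.Term V × L.Term V)) (k : ℕ) : Prop :=
  IsGenMap G₁ G₂ φ' ∧ φ'.card = φ.card ∧ φ.card - k ≤ (φ ∩ φ').card

/-- A generalization mapping `φ` is `k`-swap stable if no generalization mapping strictly
contains a `k`-swap of `φ`. -/
def KSwapStable {L : Language} {V : Type*} [DecidableEq (L.Term V)]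
    (G₁ G₂ : Finset (L.Term V)) (φ : Finset (L.Term V × L.Term V)) (k : ℕ) : Prop :=
  ¬ ∃ φ' φhat : Finset (L.Term V × L.Term V),
      IsKSwap G₁ G₂ φ φ' k ∧ IsGenMap G₁ G₂ φhat ∧ φ' ⊂ φhat

/-- A subset of a generalization mapping is a generalization mapping. -/
theorem IsGenMap.mono {L : Language} {V : Type*} {G₁ G₂ : Finset (L.Term V)}
    {φ ψ : Finset (L.Term V × L.Term V)} (hψ : IsGenMap G₁ G₂ ψ) (h : φ ⊆ ψ) :
    IsGenMap G₁ G₂ φ := by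
  obtain ⟨hmem, hinj, ρ, hρ, hrel⟩ := hψ
  exact ⟨fun p hp => hmem p (h hp), fun p hp q hq => hinj p (h hp) q (h hq),
    ρ, hρ, fun p hp => hrel p (h hp)⟩

/-- A generalization mapping that is `k`-swap stable for every `k` is maximal: no
generalization mapping of the same goals has strictly larger cardinality. -/
theorem maximal_of_kSwapStable_forall {L : Language} {V : Type*}
    [Countable V] [Infinite V] [DecidableEq (L.Term V)]
    (G₁ G₂ : Finset (L.Term V)) (φ : Finset (L.Term V × L.Term V))
    (hφ : IsGenMap G₁ G₂ φ) (hstable : ∀ k : ℕ, KSwapStable G₁ G₂ φ k) :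
    ¬ ∃ ψ : Finset (L.Term V × L.Term V), IsGenMap G₁ G₂ ψ ∧ φ.card < ψ.card := by
  rintro ⟨ψ, hψ, hcard⟩
  obtain ⟨φ', hsub, hφ'⟩ := Finset.exists_subset_card_eq hcard.le
  refine hstable φ.card ⟨φ', ψ, ⟨hψ.mono hsub, hφ', by simp⟩, hψ, ?_⟩
  refine hsub.ssubset_of_ne ?_
  rintro rfl
  exact hcard.ne' hφ'
end

section
/- Core of the correctness of the k-swap anti-unification algorithm (contrapositive of the termination condition): let φ be a generalization mapping of goals G₁ and G₂ and let k ∈ ℕ. If φ is not k-swap stable, then there exist a subset φ_s ⊆ φ with |φ_s| ≤ k, a finite set φ_G of pairs from G₁ × G₂ with |φ_G| = |φ_s| and φ_G disjoint from φ \ φ_s, and a pair (A, A') ∈ G₁ × G₂ not belonging to (φ \ φ_s) ∪ φ_G, such that (φ \ φ_s) ∪ φ_G ∪ {(A, A')} is a generalization mapping of G₁ and G₂ of cardinality |φ| + 1. -/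
open FirstOrder Language

/-- If a generalization mapping `φ` is not `k`-swap stable, then one can remove some
`φ_s ⊆ φ` with `|φ_s| ≤ k`, add a set `φ_G` of pairs from `G₁ × G₂` with
`|φ_G| = |φ_s|` disjoint from `φ \ φ_s`, and add one further fresh pair `(A, A')` from
`G₁ × G₂`, so as to obtain a generalization mapping of cardinality `|φ| + 1`. -/
theorem exists_kSwap_extension_of_not_stable {L : Language} {V : Type*}
    [Countable V] [Infinite V] [DecidableEq (L.Term V)]
    (G₁ G₂ : Finset (L.Term V)) (φ : Finset (L.Term V × L.Term V)) (k : ℕ)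
    (hφ : IsGenMap G₁ G₂ φ) (hns : ¬ KSwapStable G₁ G₂ φ k) :
    ∃ (φs φG : Finset (L.Term V × L.Term V)) (A A' : L.Term V),
      φs ⊆ φ ∧ φs.card ≤ k ∧
      (∀ p ∈ φG, p.1 ∈ G₁ ∧ p.2 ∈ G₂) ∧ φG.card = φs.card ∧
      Disjoint φG (φ \ φs) ∧
      A ∈ G₁ ∧ A' ∈ G₂ ∧ (A, A') ∉ (φ \ φs) ∪ φG ∧
      IsGenMap G₁ G₂ ((φ \ φs) ∪ φG ∪ {(A, A')}) ∧
      ((φ \ φs) ∪ φG ∪ {(A, A')}).card = φ.card + 1 := by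
  obtain ⟨φ', φhat, ⟨hφ', hcard, hinter⟩, hhat, hss⟩ := not_not.mp hns
  obtain ⟨⟨A, A'⟩, hA, hA'⟩ := Finset.exists_of_ssubset hss
  have hsdiff : φ \ (φ \ φ') ∪ φ' \ φ = φ' := by
    ext p
    simp only [Finset.mem_union, Finset.mem_sdiff]
    tauto
  refine ⟨φ \ φ', φ' \ φ, A, A', Finset.sdiff_subset, ?_,
    fun p hp => hφ'.1 p (Finset.mem_sdiff.mp hp).1, ?_, ?_,
    (hhat.1 _ hA).1, (hhat.1 _ hA).2, ?_, ?_, ?_⟩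
  · have := Finset.card_sdiff_add_card_inter φ φ'
    omega
  · exact Finset.card_sdiff_comm hcard
  · exact Finset.sdiff_disjoint.mono_right Finset.sdiff_subset
  · rwa [hsdiff]
  · rw [hsdiff]
    exact hhat.mono (Finset.union_subset hss.subset (Finset.singleton_subset_iff.mpr hA))
  · rw [hsdiff, Finset.card_union_of_disjoint (Finset.disjoint_singleton_right.mpr hA'),
      Finset.card_singleton, hcard]
end
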